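/- Fix R > 0 and define ρ₂ : ℝ → ℝ by ρ₂(d) = 0 if d > R, ρ₂(d) = (1/(πR²))[R²·arccos(d/R) - d·√(R² - d²)] if -R ≤ d ≤ R, and ρ₂(d) = 1 if d < -R. Then ρ₂ is Lipschitz continuous with Lipschitz constant 2/(πR). -/

import Mathlib

open Real

/-- The 2-dimensional projected density of the geometry projection method:
the area fraction of a sampling disk of radius `R` cut by a straight boundary
at signed distance `d` from the disk center. -/
noncomputable def rho2 (R d : ℝ) : ℝ :=
  if R < d then 0
  else if d < -R then 1
  else (1 / (π * R ^ 2)) * (R ^ 2 * Real.arccos (d / R) - d * Real.sqrt (R ^ 2 - d ^ 2))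

theorem rho2_eq {R : ℝ} (hR : 0 < R) (d : ℝ) :
    rho2 R d =
      (1 / (π * R ^ 2)) * (R ^ 2 * Real.arccos (d / R) - d * Real.sqrt (R ^ 2 - d ^ 2)) := by
  unfold rho2
  split_ifs with h₁ h₂
  · rw [Real.arccos_of_one_le ((one_le_div hR).2 h₁.le), Real.sqrt_eq_zero_of_nonpos (by nlinarith)]
    simp
  · rw [Real.arccos_of_le_neg_one ((div_le_iff₀ hR).2 (by linarith)),
      Real.sqrt_eq_zero_of_nonpos (by nlinarith)]
    field_simp
    simp
  · rfl

theorem continuous_rho2 {R : ℝ} (hR : 0 < R) : Continuous (rho2 R) := by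
  rw [funext (rho2_eq hR)]
  fun_prop

theorem hasDerivAt_rho2 {R d : ℝ} (hR : 0 < R) (hd : d ∈ Set.Ioo (-R) R) :
    HasDerivAt (rho2 R) (-(2 * Real.sqrt (R ^ 2 - d ^ 2) / (π * R ^ 2))) d := by
  obtain ⟨h₁, h₂⟩ := hd
  have hpos : 0 < R ^ 2 - d ^ 2 := by nlinarith
  have hs : 0 < Real.sqrt (R ^ 2 - d ^ 2) := Real.sqrt_pos.2 hpos
  have hsq : Real.sqrt (R ^ 2 - d ^ 2) ^ 2 = R ^ 2 - d ^ 2 := Real.sq_sqrt hpos.le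
  have hdiv : Real.sqrt (1 - (d / R) ^ 2) = Real.sqrt (R ^ 2 - d ^ 2) / R := by
    rw [show 1 - (d / R) ^ 2 = (R ^ 2 - d ^ 2) / R ^ 2 by field_simp, Real.sqrt_div hpos.le,
      Real.sqrt_sq hR.le]
  have hne₁ : d / R ≠ -1 := by
    rw [Ne, div_eq_iff hR.ne']
    linarith
  have hne₂ : d / R ≠ 1 := by
    rw [Ne, div_eq_iff hR.ne']
    linarith
  have harccos := (Real.hasDerivAt_arccos hne₁ hne₂).comp d ((hasDerivAt_id d).div_const R)
  have hsqrt := (((hasDerivAt_id d).pow 2).const_sub (R ^ 2)).sqrt hpos.ne'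
  have h := ((harccos.const_mul (R ^ 2)).sub ((hasDerivAt_id d).mul hsqrt)).const_mul
    (1 / (π * R ^ 2))
  rw [funext (rho2_eq hR)]
  refine h.congr_deriv ?_
  simp only [id, Pi.pow_apply, hdiv]
  field_simp
  simp only [hsq]
  ring

theorem lipschitzOnWith_rho2_Icc {R : ℝ} (hR : 0 < R) :
    LipschitzOnWith (Real.toNNReal (2 / (π * R))) (rho2 R) (Set.Icc (-R) R) := by
  rw [← closure_Ioo (by linarith : -R ≠ R)]
  refine LipschitzOnWith.closure (continuous_rho2 hR).continuousOn ?_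
  refine (convex_Ioo _ _).lipschitzOnWith_of_nnnorm_hasDerivWithin_le
    (fun d hd => (hasDerivAt_rho2 hR hd).hasDerivWithinAt) fun d hd => ?_
  rw [← NNReal.coe_le_coe, coe_nnnorm, Real.coe_toNNReal _ (by positivity), norm_neg,
    Real.norm_of_nonneg (by positivity)]
  have hle : Real.sqrt (R ^ 2 - d ^ 2) ≤ R :=
    Real.sqrt_le_iff.2 ⟨hR.le, by nlinarith [sq_nonneg d]⟩
  calc 2 * Real.sqrt (R ^ 2 - d ^ 2) / (π * R ^ 2) ≤ 2 * R / (π * R ^ 2) := by gcongr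
    _ = 2 / (π * R) := by field_simp

theorem rho2_projIcc {R : ℝ} (hR : 0 < R) (d : ℝ) :
    rho2 R (Set.projIcc (-R) R (by linarith) d) = rho2 R d := by
  rcases le_or_gt d (-R) with h | h
  · rw [Set.projIcc_of_le_left _ h, rho2_eq hR, rho2_eq hR,
      Real.arccos_of_le_neg_one ((div_le_iff₀ hR).2 (by linarith : d ≤ -1 * R)),
      Real.sqrt_eq_zero_of_nonpos (by nlinarith : R ^ 2 - d ^ 2 ≤ 0)]
    simp [hR.ne']
  · rcases le_or_gt R d with h' | h'
    · rw [Set.projIcc_of_right_le _ h', rho2_eq hR, rho2_eq hR,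
        Real.arccos_of_one_le ((one_le_div hR).2 h'),
        Real.sqrt_eq_zero_of_nonpos (by nlinarith : R ^ 2 - d ^ 2 ≤ 0)]
      simp [hR.ne']
    · rw [Set.projIcc_of_mem _ ⟨h.le, h'.le⟩]

/-- The 2-dimensional projected density is Lipschitz continuous with Lipschitz
constant `2/(πR)`. -/
theorem rho2_lipschitz (R : ℝ) (hR : 0 < R) :
    LipschitzWith (Real.toNNReal (2 / (π * R))) (rho2 R) := by
  have h := (lipschitzOnWith_rho2_Icc hR).to_restrict.comp
    (LipschitzWith.projIcc (by linarith : -R ≤ R))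
  rw [mul_one] at h
  exact (funext (rho2_projIcc hR) : _ = rho2 R) ▸ h
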